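/- arXiv:1701.04374 — 2 statements merged into one kernel-verified Lean document; each statement's English description precedes it below -/
import Mathlib

section
/- Let G be an infinite group with a finite generating set X such that the spherical growth series s_{G,X}(t) is a rational function. Then there exist constants α ∈ ℤ_{≥0}, λ ∈ [1,∞) and real numbers D > C > 0 such that C·n^α·λ^n ≤ |S_{G,X}(n)| ≤ D·n^α·λ^n for all n ≥ 1. -/
/-- The word length of `g` with respect to a generating set `X`: the least `n` such that
`g` is a product of `n` elements of `X ∪ X⁻¹`. -/
noncomputable def wordLength {G : Type*} [Group G] (X : Set G) (g : G) : ℕ :=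
  sInf {n | ∃ l : List G, l.length = n ∧ (∀ x ∈ l, x ∈ X ∨ x⁻¹ ∈ X) ∧ l.prod = g}

/-- The sphere of radius `n` in `G` with respect to `X`. -/
noncomputable def sphere {G : Type*} [Group G] (X : Set G) (n : ℕ) : Set G :=
  {g | wordLength X g = n}

/-- The ball of radius `n` in `G` with respect to `X`. -/
noncomputable def ball {G : Type*} [Group G] (X : Set G) (n : ℕ) : Set G :=
  {g | wordLength X g ≤ n}

section Helpers
open Filter Asymptotics Topology

def GoodSeq {V : Type*} [NormedAddCommGroup V] (f : ℕ → V) : Prop :=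
  (∀ᶠ n in atTop, f n = 0) ∨ ∃ (α : ℕ) (lam : ℝ), 0 < lam ∧
    f =Θ[atTop] (fun n : ℕ => (n : ℝ) ^ α * lam ^ n)

lemma model_pow_lt {a b : ℕ} (h : a < b) (l : ℝ) :
    (fun n : ℕ => (n : ℝ) ^ a * l ^ n) =o[atTop] (fun n : ℕ => (n : ℝ) ^ b * l ^ n) := by
  refine IsLittleO.mul_isBigO ?_ (isBigO_refl _ _)
  exact (isLittleO_pow_pow_atTop_of_lt h).comp_tendsto tendsto_natCast_atTop_atTop

lemma model_lt {a b : ℕ} {l k : ℝ} (hl : 0 < l) (h : l < k) :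
    (fun n : ℕ => (n : ℝ) ^ a * l ^ n) =O[atTop] (fun n : ℕ => (n : ℝ) ^ b * k ^ n) := by
  have h1 := (isLittleO_pow_const_mul_const_pow_const_pow_of_norm_lt (R := ℝ) a (r₁ := l) (r₂ := k)
    (by rwa [Real.norm_of_nonneg hl.le])).isBigO
  refine h1.trans ?_
  refine IsBigO.of_bound 1 ?_
  filter_upwards [eventually_ge_atTop 1] with n hn
  have hk : 0 < k := hl.trans h
  have : (1:ℝ) ≤ (n:ℝ) ^ b := one_le_pow₀ (by exact_mod_cast hn)
  rw [Real.norm_of_nonneg (by positivity), Real.norm_of_nonneg (by positivity)]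
  nlinarith [pow_pos hk n]

lemma model_total (a b : ℕ) {l k : ℝ} (hl : 0 < l) (hk : 0 < k) :
    (fun n : ℕ => (n : ℝ) ^ a * l ^ n) =O[atTop] (fun n : ℕ => (n : ℝ) ^ b * k ^ n) ∨
    (fun n : ℕ => (n : ℝ) ^ b * k ^ n) =O[atTop] (fun n : ℕ => (n : ℝ) ^ a * l ^ n) := by
  rcases lt_trichotomy l k with h | h | h
  · exact Or.inl (model_lt hl h)
  · subst h
    rcases lt_trichotomy a b with h | h | h
    · exact Or.inl (model_pow_lt h l).isBigO
    · subst h; exact Or.inl (isBigO_refl _ _)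
    · exact Or.inr (model_pow_lt h l).isBigO
  · exact Or.inr (model_lt hk h)

lemma GoodSeq.add {V : Type*} [NormedAddCommGroup V] {f g : ℕ → V} (hf : GoodSeq f)
    (hg : GoodSeq g) (h1 : f =O[atTop] (fun n => f n + g n))
    (h2 : g =O[atTop] (fun n => f n + g n)) : GoodSeq (fun n => f n + g n) := by
  rcases hf with hf | ⟨a, l, hl, hf⟩
  · rcases hg with hg | ⟨b, k, hk, hg⟩
    · left
      filter_upwards [hf, hg] with n h h'
      simp [h, h']
    · right
      refine ⟨b, k, hk, ?_⟩
      refine EventuallyEq.trans_isTheta ?_ hg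
      filter_upwards [hf] with n h
      simp [h]
  · rcases hg with hg | ⟨b, k, hk, hg⟩
    · right
      refine ⟨a, l, hl, ?_⟩
      refine EventuallyEq.trans_isTheta ?_ hf
      filter_upwards [hg] with n h
      simp [h]
    · right
      rcases model_total a b hl hk with h | h
      · exact ⟨b, k, hk, (hf.1.trans h).add hg.1, hg.2.trans h2⟩
      · exact ⟨a, l, hl, hf.1.add (hg.1.trans h), hf.2.trans h1⟩

section Lin
variable {V : Type*} [NormedAddCommGroup V] [NormedSpace ℂ V]

lemma term_theta (j : ℕ) (μ : ℂ) {w : V} (hw : w ≠ 0) :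
    (fun n : ℕ => ((n.choose j : ℂ) * μ ^ n) • w) =Θ[atTop]
      (fun n : ℕ => (n : ℝ) ^ j * ‖μ‖ ^ n) := by
  rw [← isTheta_norm_left]
  have : (fun n : ℕ => ‖((n.choose j : ℂ) * μ ^ n) • w‖) =
      fun n : ℕ => ‖w‖ * ((n.choose j : ℝ) * ‖μ‖ ^ n) := by
    funext n
    simp [norm_smul]; ring
  rw [this, isTheta_const_mul_left (norm_ne_zero_iff.2 hw)]
  exact (isTheta_choose j).mul (isTheta_refl _ _)

lemma good_gen (M : Module.End ℂ V) (μ : ℂ) (v : V) (hv : v ∈ M.maxGenEigenspace μ) :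
    GoodSeq (fun n => (M ^ n) v) := by
  rw [Module.End.mem_maxGenEigenspace] at hv
  by_cases hμ : μ = 0
  · subst hμ
    obtain ⟨k, hk⟩ := hv
    left
    filter_upwards [eventually_ge_atTop k] with n hn
    obtain ⟨m, rfl⟩ := Nat.exists_eq_add_of_le hn
    rw [add_comm, pow_add, Module.End.mul_apply]
    simp at hk
    simp [hk]
  by_cases hv0 : v = 0
  · left; simp [hv0]
  classical
  set N := M - μ • (1 : Module.End ℂ V) with hN
  obtain ⟨d, hd, hd'⟩ : ∃ d, (N ^ d) v ≠ 0 ∧ (N ^ (d+1)) v = 0 := by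
    have h0 : Nat.find hv ≠ 0 := by
      intro h
      have := Nat.find_spec hv
      rw [h] at this
      simp [hv0] at this
    refine ⟨Nat.find hv - 1, Nat.find_min hv (by omega), ?_⟩
    rw [Nat.sub_add_cancel (by omega)]
    exact Nat.find_spec hv
  have hbig : ∀ j, d < j → (N ^ j) v = 0 := by
    intro j hj
    obtain ⟨m, rfl⟩ := Nat.exists_eq_add_of_le (Nat.succ_le_of_lt hj)
    rw [add_comm, pow_add, Module.End.mul_apply, Nat.succ_eq_add_one, hd', map_zero]
  have hM : M = N + μ • (1 : Module.End ℂ V) := by simp [hN]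
  have hcomm : Commute N (μ • (1 : Module.End ℂ V)) := (Commute.one_right N).smul_right μ
  have hexp : ∀ᶠ n in atTop, (M ^ n) v =
      ∑ j ∈ Finset.range (d+1), ((n.choose j : ℂ) * μ ^ n) • ((μ ^ j)⁻¹ • (N ^ j) v) := by
    filter_upwards [eventually_ge_atTop d] with n hn
    conv_lhs => rw [hM, hcomm.add_pow, LinearMap.sum_apply]
    symm
    refine Finset.sum_subset_zero_on_sdiff (by simpa using hn) ?_ ?_
    · intro j hj
      simp only [Finset.mem_sdiff, Finset.mem_range] at hj
      simp [smul_pow, ← nsmul_eq_mul', hbig j (by omega)]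
    · intro j hj
      simp only [Finset.mem_range] at hj
      obtain ⟨m, rfl⟩ := Nat.exists_eq_add_of_le (show j ≤ n by omega)
      simp only [smul_pow, one_pow, ← nsmul_eq_mul', smul_smul, LinearMap.smul_apply,
        mul_smul_comm, mul_one, Nat.add_sub_cancel_left, ← Nat.cast_smul_eq_nsmul ℂ]
      congr 1
      rw [pow_add]
      field_simp
  right
  refine ⟨d, ‖μ‖, norm_pos_iff.2 hμ, ?_⟩
  refine EventuallyEq.trans_isTheta hexp ?_
  simp only [Finset.sum_range_succ]
  refine IsLittleO.add_isTheta ?_ (term_theta d μ (smul_ne_zero (inv_ne_zero (pow_ne_zero _ hμ)) hd))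
  refine IsLittleO.fun_sum fun j hj => ?_
  by_cases hw : (μ ^ j)⁻¹ • (N ^ j) v = 0
  · simp [hw]
  · exact (term_theta j μ hw).1.trans_isLittleO (model_pow_lt (Finset.mem_range.1 hj) _)

lemma good_disj [FiniteDimensional ℂ V] (M : Module.End ℂ V) (U W : Submodule ℂ V)
    (hd : Disjoint U W)
    (hU : ∀ x ∈ U, M x ∈ U) (hW : ∀ x ∈ W, M x ∈ W) (u w : V) (hu : u ∈ U) (hw : w ∈ W)
    (gu : GoodSeq (fun n => (M ^ n) u)) (gw : GoodSeq (fun n => (M ^ n) w)) :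
    GoodSeq (fun n => (M ^ n) (u + w)) := by
  have hUn : ∀ n, (M ^ n) u ∈ U := by
    intro n
    induction n with
    | zero => simpa
    | succ n ih => rw [pow_succ', Module.End.mul_apply]; exact hU _ ih
  have hWn : ∀ n, (M ^ n) w ∈ W := by
    intro n
    induction n with
    | zero => simpa
    | succ n ih => rw [pow_succ', Module.End.mul_apply]; exact hW _ ih
  let L : (U × W) →ₗ[ℂ] V := LinearMap.coprod U.subtype W.subtype
  have hL : LinearMap.ker L = ⊥ := by
    rw [LinearMap.ker_eq_bot']
    rintro ⟨x, y⟩ h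
    have h' : (x : V) + y = 0 := by simpa [L] using h
    have hx : (x : V) ∈ W := by
      rw [eq_neg_of_add_eq_zero_left h']; exact W.neg_mem y.2
    have hx0 : (x : V) = 0 := Submodule.disjoint_def.1 hd _ x.2 hx
    rw [hx0, zero_add] at h'
    ext <;> simp [hx0, h']
  obtain ⟨K, -, hK⟩ := L.exists_antilipschitzWith hL
  have key : ∀ n, ‖(M ^ n) u‖ ≤ K * ‖(M ^ n) u + (M ^ n) w‖ ∧
      ‖(M ^ n) w‖ ≤ K * ‖(M ^ n) u + (M ^ n) w‖ := by
    intro n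
    have := hK.le_mul_dist (⟨(M ^ n) u, hUn n⟩, ⟨(M ^ n) w, hWn n⟩) 0
    simp only [dist_zero_right, map_zero, Prod.norm_def, max_le_iff] at this
    simpa [L] using this
  simp only [map_add]
  exact gu.add gw (IsBigO.of_bound K (Eventually.of_forall fun n => (key n).1))
    (IsBigO.of_bound K (Eventually.of_forall fun n => (key n).2))

lemma good_all [FiniteDimensional ℂ V] (M : Module.End ℂ V) (v : V) :
    GoodSeq (fun n => (M ^ n) v) := by
  classical
  have inv : ∀ μ, ∀ x ∈ M.maxGenEigenspace μ, M x ∈ M.maxGenEigenspace μ := fun μ x hx =>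
    Module.End.mapsTo_maxGenEigenspace_of_comm (Commute.refl M) μ hx
  have main : ∀ s : Finset ℂ, (∀ x ∈ s.sup M.maxGenEigenspace, M x ∈ s.sup M.maxGenEigenspace) ∧
      ∀ v ∈ s.sup M.maxGenEigenspace, GoodSeq (fun n => (M ^ n) v) := by
    intro s
    induction s using Finset.induction_on with
    | empty =>
      refine ⟨by simp, ?_⟩
      intro v hv
      have : v = 0 := by simpa using hv
      left; simp [this]
    | insert a s ha ih =>
      rw [Finset.sup_insert]
      constructor
      · intro x hx
        obtain ⟨y, hy, z, hz, rfl⟩ := Submodule.mem_sup.1 hx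
        rw [map_add]
        exact Submodule.add_mem_sup (inv a y hy) (ih.1 z hz)
      · intro x hx
        obtain ⟨y, hy, z, hz, rfl⟩ := Submodule.mem_sup.1 hx
        refine good_disj M _ _ ?_ (inv a) ih.1 y z hy hz (good_gen M a y hy) (ih.2 z hz)
        have := (Module.End.independent_maxGenEigenspace M).disjoint_biSup (x := a) (y := (s : Set ℂ))
          (by simpa using ha)
        rw [Finset.sup_eq_iSup]
        exact this
  have hv : v ∈ ⨆ μ, M.maxGenEigenspace μ := by
    rw [Module.End.iSup_maxGenEigenspace_eq_top]; trivial
  obtain ⟨s, hs⟩ := Submodule.exists_finset_of_mem_iSup _ hv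
  exact (main s).2 v (by rw [Finset.sup_eq_iSup]; exact hs)

end Lin

lemma model_shift (α N : ℕ) {lam : ℝ} (hl : 0 < lam) :
    (fun n : ℕ => (n : ℝ) ^ α * lam ^ n) =Θ[atTop]
      (fun n : ℕ => ((n + N : ℕ) : ℝ) ^ α * lam ^ (n + N)) := by
  have h1 : (fun n : ℕ => (n : ℝ)) =Θ[atTop] (fun n : ℕ => ((n + N : ℕ) : ℝ)) := by
    constructor
    · refine IsBigO.of_bound 1 (Eventually.of_forall fun n => ?_)
      rw [Real.norm_of_nonneg (by positivity), Real.norm_of_nonneg (by positivity)]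
      push_cast
      linarith [(Nat.cast_nonneg N : (0:ℝ) ≤ N)]
    · refine IsBigO.of_bound (N + 1) ?_
      filter_upwards [eventually_ge_atTop 1] with n hn
      rw [Real.norm_of_nonneg (by positivity), Real.norm_of_nonneg (by positivity)]
      push_cast
      have : (1:ℝ) ≤ n := by exact_mod_cast hn
      nlinarith [(Nat.cast_nonneg N : (0:ℝ) ≤ N)]
  have h2 : (fun n : ℕ => lam ^ n) =Θ[atTop] (fun n : ℕ => lam ^ (n + N)) := by
    simp only [pow_add, mul_comm _ (lam ^ N)]
    rw [isTheta_const_mul_right (pow_ne_zero _ hl.ne')]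
  exact (h1.pow α).mul h2

lemma rec_of_rational (a : ℕ → ℝ) (p q : Polynomial ℝ) (hq : q ≠ 0)
    (h : (q : PowerSeries ℝ) * PowerSeries.mk a = (p : PowerSeries ℝ)) :
    ∃ (K N : ℕ) (c : Fin K → ℝ), ∀ m, N ≤ m → a (m + K) = ∑ i : Fin K, c i * a (m + i) := by
  set r := q.natTrailingDegree with hr
  have hrD : r ≤ q.natDegree := Polynomial.natTrailingDegree_le_natDegree q
  obtain ⟨K, hK⟩ := Nat.exists_eq_add_of_le hrD
  have hqr : q.coeff r ≠ 0 := by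
    have := Polynomial.trailingCoeff_nonzero_iff_nonzero.2 hq
    exact this
  refine ⟨K, p.natDegree + 1, fun i => -(q.coeff (r + K - i) / q.coeff r), fun m hm => ?_⟩
  have h1 := congrArg (PowerSeries.coeff (m + (K + 1) + r - 1)) h
  rw [mul_comm, PowerSeries.coeff_mul, Finset.Nat.sum_antidiagonal_eq_sum_range_succ_mk,
    Polynomial.coeff_coe, Polynomial.coeff_eq_zero_of_natDegree_lt (by omega)] at h1
  simp only [PowerSeries.coeff_mk, Polynomial.coeff_coe] at h1
  rw [show (m + (K + 1) + r - 1).succ = m + (K + 1) + r by omega, Finset.sum_range_add,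
    Finset.sum_range_add] at h1
  have z1 : ∑ x ∈ Finset.range m, a x * q.coeff (m + (K + 1) + r - 1 - x) = 0 := by
    refine Finset.sum_eq_zero fun x hx => ?_
    rw [Finset.mem_range] at hx
    rw [Polynomial.coeff_eq_zero_of_natDegree_lt (by omega), mul_zero]
  have z2 : ∑ x ∈ Finset.range r, a (m + (K + 1) + x) *
      q.coeff (m + (K + 1) + r - 1 - (m + (K + 1) + x)) = 0 := by
    refine Finset.sum_eq_zero fun x hx => ?_
    rw [Finset.mem_range] at hx
    rw [Polynomial.coeff_eq_zero_of_lt_natTrailingDegree (by omega), mul_zero]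
  rw [z1, z2, Finset.sum_range_succ, show m + (K + 1) + r - 1 - (m + K) = r by omega] at h1
  have h2 : a (m + K) * q.coeff r = - ∑ x ∈ Finset.range K,
      a (m + x) * q.coeff (m + (K + 1) + r - 1 - (m + x)) := by linarith
  rw [Fin.sum_univ_eq_sum_range (fun i => -(q.coeff (r + K - i) / q.coeff r) * a (m + i)) K]
  rw [eq_div_of_mul_eq hqr h2, ← Finset.sum_neg_distrib, Finset.sum_div]
  refine Finset.sum_congr rfl fun x hx => ?_
  rw [Finset.mem_range] at hx
  rw [show m + (K + 1) + r - 1 - (m + x) = r + K - x by omega]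
  ring

lemma seq_main (a : ℕ → ℝ) (ha : ∀ n, 1 ≤ a n) (hsub : ∀ m n, a (m + n) ≤ a m * a n)
    (p q : Polynomial ℝ) (hq : q ≠ 0)
    (h : (q : PowerSeries ℝ) * PowerSeries.mk a = (p : PowerSeries ℝ)) :
    ∃ (α : ℕ) (lam C D : ℝ), 1 ≤ lam ∧ 0 < C ∧ C < D ∧
      ∀ n : ℕ, 1 ≤ n →
        C * (n : ℝ) ^ α * lam ^ n ≤ a n ∧ a n ≤ D * (n : ℝ) ^ α * lam ^ n := by
  have ha0 : ∀ n, 0 < a n := fun n => zero_lt_one.trans_le (ha n)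
  obtain ⟨K, N, c, hc⟩ := rec_of_rational a p q hq h
  have hK : 0 < K := by
    rcases Nat.eq_zero_or_pos K with rfl | hK
    · have := hc N le_rfl
      simp at this
      exact absurd this (ha0 N).ne'
    · exact hK
  let E : LinearRecurrence ℂ := ⟨K, fun i => (c i : ℂ)⟩
  let win : ℕ → (Fin K → ℂ) := fun m i => (a (m + N + i) : ℂ)
  have hwin : ∀ m, win (m + 1) = E.tupleSucc (win m) := by
    intro m
    funext i
    by_cases hi : (i : ℕ) + 1 < K
    · have : E.tupleSucc (win m) i = win m ⟨i + 1, hi⟩ := by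
        simp [LinearRecurrence.tupleSucc, E, hi]
      rw [this]
      simp only [win]
      congr 2
      omega
    · have : E.tupleSucc (win m) i = ∑ j, (c j : ℂ) * win m j := by
        simp [LinearRecurrence.tupleSucc, E, hi]
      rw [this]
      simp only [win]
      have h2 := hc (m + N) (by omega)
      rw [show m + 1 + N + (i : ℕ) = m + N + K by omega, h2]
      push_cast
      rfl
  have hpow : ∀ m, win m = (E.tupleSucc ^ m : Module.End ℂ (Fin K → ℂ)) (win 0) := by
    intro m
    induction m with
    | zero => simp
    | succ m ih => rw [pow_succ', Module.End.mul_apply, hwin, ih]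
  have good : GoodSeq win := by
    have := good_all (V := Fin K → ℂ) E.tupleSucc (win 0)
    rwa [show win = _ from funext hpow]
  have hwa : (fun m => a (m + N)) =Θ[atTop] win := by
    constructor
    · refine IsBigO.of_bound 1 (Eventually.of_forall fun m => ?_)
      have := norm_le_pi_norm (win m) ⟨0, hK⟩
      rw [one_mul]
      simpa [win] using this
    · refine IsBigO.of_bound (∑ i ∈ Finset.range K, a i) (Eventually.of_forall fun m => ?_)
      have hs : 0 ≤ ∑ i ∈ Finset.range K, a i := Finset.sum_nonneg fun i _ => (ha0 i).le
      rw [pi_norm_le_iff_of_nonneg (by positivity)]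
      intro i
      simp only [win, Complex.norm_real, Real.norm_of_nonneg (ha0 _).le]
      refine (hsub _ _).trans ?_
      rw [mul_comm]
      refine mul_le_mul_of_nonneg_right ?_ (ha0 _).le
      exact Finset.single_le_sum (f := a) (fun i _ => (ha0 i).le) (Finset.mem_range.2 i.2)
  rcases good with hz | ⟨α, lam, hl, hT⟩
  · obtain ⟨m, hm⟩ := hz.exists
    have := congrFun hm ⟨0, hK⟩
    simp [win] at this
    exact absurd this (ha0 _).ne'
  have h3 := (hwa.trans hT).trans (model_shift α N hl)
  have h4 : a =Θ[atTop] (fun n : ℕ => (n : ℝ) ^ α * lam ^ n) := by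
    constructor
    · have := h3.1
      rw [← map_add_atTop_eq_nat N, isBigO_map]
      exact this
    · have := h3.2
      rw [← map_add_atTop_eq_nat N, isBigO_map]
      exact this
  have hl1 : 1 ≤ lam := by
    by_contra hlt
    push Not at hlt
    have ht : Tendsto (fun n : ℕ => (n : ℝ) ^ α * lam ^ n) atTop (𝓝 0) :=
      tendsto_pow_const_mul_const_pow_of_lt_one α hl.le hlt
    have ht2 := h4.tendsto_zero_iff.2 ht
    have := ge_of_tendsto' ht2 ha
    linarith
  obtain ⟨D, hD, hD'⟩ := bound_of_isBigO_nat_atTop h4.1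
  obtain ⟨C, hC, hC'⟩ := bound_of_isBigO_nat_atTop h4.2
  have hmin : 0 < min C⁻¹ D := lt_min (inv_pos.2 hC) hD
  refine ⟨α, lam, C⁻¹, max D (C⁻¹ + 1), hl1, inv_pos.2 hC, ?_, fun n hn => ?_⟩
  · exact lt_max_of_lt_right (by linarith)
  · have hn0 : (0:ℝ) < n := by exact_mod_cast hn
    have hp : 0 < (n : ℝ) ^ α * lam ^ n := by positivity
    have e1 := hD' hp.ne'
    have e2 := hC' (ha0 n).ne'
    rw [Real.norm_of_nonneg (ha0 n).le, Real.norm_of_nonneg hp.le] at e1 e2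
    rw [mul_assoc, mul_assoc]
    constructor
    · rw [inv_mul_le_iff₀ hC]; exact e2
    · exact e1.trans (mul_le_mul_of_nonneg_right (le_max_left _ _) hp.le)

section Grp
variable {G : Type*} [Group G] {X : Set G}

lemma exists_word (hXgen : Subgroup.closure X = ⊤) (g : G) :
    ∃ l : List G, (∀ x ∈ l, x ∈ X ∨ x⁻¹ ∈ X) ∧ l.prod = g := by
  have hg : g ∈ Subgroup.closure X := by rw [hXgen]; trivial
  rw [← Subgroup.mem_toSubmonoid, Subgroup.closure_toSubmonoid] at hg
  obtain ⟨l, hl, hp⟩ := Submonoid.exists_list_of_mem_closure hg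
  exact ⟨l, fun x hx => by simpa using hl x hx, hp⟩

lemma exists_geod (hXgen : Subgroup.closure X = ⊤) (g : G) :
    ∃ l : List G, l.length = wordLength X g ∧ (∀ x ∈ l, x ∈ X ∨ x⁻¹ ∈ X) ∧ l.prod = g := by
  obtain ⟨l, h1, h2⟩ := exists_word hXgen g
  exact Nat.sInf_mem (s := {n | ∃ l : List G, l.length = n ∧ (∀ x ∈ l, x ∈ X ∨ x⁻¹ ∈ X) ∧
    l.prod = g}) ⟨l.length, l, rfl, h1, h2⟩

lemma wordLength_le (l : List G) (h : ∀ x ∈ l, x ∈ X ∨ x⁻¹ ∈ X) :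
    wordLength X l.prod ≤ l.length := Nat.sInf_le ⟨l, rfl, h, rfl⟩

lemma wordLength_mul_le (hXgen : Subgroup.closure X = ⊤) (g h : G) :
    wordLength X (g * h) ≤ wordLength X g + wordLength X h := by
  obtain ⟨l, h1, h2, rfl⟩ := exists_geod hXgen g
  obtain ⟨l', h1', h2', rfl⟩ := exists_geod hXgen h
  rw [← h1, ← h1', ← List.prod_append, ← List.length_append]
  refine wordLength_le _ fun x hx => ?_
  rcases List.mem_append.1 hx with hx | hx
  · exact h2 x hx
  · exact h2' x hx

lemma sphere_split (hXgen : Subgroup.closure X = ⊤) (m n : ℕ) (g : G)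
    (hg : g ∈ sphere X (m + n)) : ∃ u ∈ sphere X m, ∃ v ∈ sphere X n, u * v = g := by
  have hg' : wordLength X g = m + n := hg
  obtain ⟨l, h1, h2, h3⟩ := exists_geod hXgen g
  have hp : (l.take m).prod * (l.drop m).prod = g := by
    rw [← List.prod_append, List.take_append_drop, h3]
  have e1 := wordLength_le (X := X) (l.take m) fun x hx => h2 x (List.mem_of_mem_take hx)
  have e2 := wordLength_le (X := X) (l.drop m) fun x hx => h2 x (List.mem_of_mem_drop hx)
  have e3 := wordLength_mul_le hXgen (l.take m).prod (l.drop m).prod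
  rw [hp] at e3
  rw [List.length_take] at e1
  rw [List.length_drop] at e2
  refine ⟨_, ?_, _, ?_, hp⟩
  · change wordLength X _ = m
    omega
  · change wordLength X _ = n
    omega

open scoped Pointwise in
lemma sphere_finite (hXfin : X.Finite) (hXgen : Subgroup.closure X = ⊤) (n : ℕ) :
    (sphere X n).Finite := by
  have hT : (X ∪ X⁻¹).Finite := hXfin.union hXfin.inv
  have h0 : (sphere X 0).Finite := by
    refine (Set.finite_singleton (1 : G)).subset fun g hg => ?_
    have hg' : wordLength X g = 0 := hg
    obtain ⟨l, h1, h2, h3⟩ := exists_geod hXgen g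
    rw [hg', List.length_eq_zero_iff] at h1
    subst h1
    simpa using h3.symm
  have h1 : (sphere X 1).Finite := by
    refine hT.subset fun g hg => ?_
    have hg' : wordLength X g = 1 := hg
    obtain ⟨l, h1, h2, h3⟩ := exists_geod hXgen g
    rw [hg', List.length_eq_one_iff] at h1
    obtain ⟨x, rfl⟩ := h1
    have hx := h2 x (by simp)
    simp at h3
    subst h3
    simpa using hx
  induction n with
  | zero => exact h0
  | succ n ih =>
    refine (ih.mul h1).subset fun g hg => ?_
    obtain ⟨u, hu, v, hv, rfl⟩ := sphere_split hXgen n 1 g hg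
    exact Set.mul_mem_mul hu hv

lemma sphere_nonempty [Infinite G] (hXfin : X.Finite) (hXgen : Subgroup.closure X = ⊤) (n : ℕ) :
    (sphere X n).Nonempty := by
  have hfin : (⋃ i ∈ Finset.range n, sphere X i).Finite :=
    Set.Finite.biUnion (Finset.finite_toSet _) fun i _ => sphere_finite hXfin hXgen i
  obtain ⟨g, hg⟩ := hfin.infinite_compl.nonempty
  have hn : n ≤ wordLength X g := by
    by_contra hlt
    push Not at hlt
    exact hg (Set.mem_biUnion (x := wordLength X g) (by simpa using hlt) rfl)
  obtain ⟨k, hk⟩ := Nat.exists_eq_add_of_le hn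
  obtain ⟨u, hu, -⟩ := sphere_split hXgen n k g hk
  exact ⟨u, hu⟩

open scoped Pointwise in
lemma sphere_card_le (hXfin : X.Finite) (hXgen : Subgroup.closure X = ⊤) (m n : ℕ) :
    Nat.card (sphere X (m + n)) ≤ Nat.card (sphere X m) * Nat.card (sphere X n) := by
  refine le_trans ?_ (Set.natCard_mul_le (s := sphere X m) (t := sphere X n))
  refine Nat.card_mono ((sphere_finite hXfin hXgen m).mul (sphere_finite hXfin hXgen n)) ?_
  intro g hg
  obtain ⟨u, hu, v, hv, rfl⟩ := sphere_split hXgen m n g hg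
  exact Set.mul_mem_mul hu hv

end Grp

end Helpers

theorem statement0 {G : Type*} [Group G] [Infinite G] (X : Set G) (hXfin : X.Finite)
    (hXgen : Subgroup.closure X = ⊤)
    (hrat : ∃ p q : Polynomial ℝ, q ≠ 0 ∧
      (q : PowerSeries ℝ) * PowerSeries.mk (fun n => (Nat.card (sphere X n) : ℝ)) =
        (p : PowerSeries ℝ)) :
    ∃ (α : ℕ) (lam C D : ℝ), 1 ≤ lam ∧ 0 < C ∧ C < D ∧
      ∀ n : ℕ, 1 ≤ n →
        C * (n : ℝ) ^ α * lam ^ n ≤ (Nat.card (sphere X n) : ℝ) ∧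
        (Nat.card (sphere X n) : ℝ) ≤ D * (n : ℝ) ^ α * lam ^ n := by
  obtain ⟨p, q, hq, h⟩ := hrat
  refine seq_main (fun n => (Nat.card (sphere X n) : ℝ)) (fun n => ?_) (fun m n => ?_) p q hq h
  · have := (sphere_finite hXfin hXgen n).to_subtype
    have := (sphere_nonempty hXfin hXgen n).to_subtype
    exact_mod_cast Nat.card_pos (α := sphere X n)
  · exact_mod_cast sphere_card_le hXfin hXgen m n
end

section
/- Let (a_n)_{n=0}^∞ be a sequence of positive integers that is submultiplicative, i.e. a_{m+n} ≤ a_m·a_n for all m, n ≥ 0, and suppose the formal power series s(t) = ∑_{n≥0} a_n t^n is a rational function. Then there exist constants α ∈ ℤ_{≥0}, λ ∈ [1,∞) and real numbers D > C > 0 such that C·n^α·λ^n ≤ a_n ≤ D·n^α·λ^n for all n ≥ 1. -/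
open Filter Asymptotics Topology

lemma comp1 {V : Type*} [NormedAddCommGroup V] [NormedSpace ℂ V] (T : Module.End ℂ V) (μ : ℂ) (hμ : μ ≠ 0)
    (w : V) (hw0 : w ≠ 0) (hw : w ∈ T.maxGenEigenspace μ) :
    ∃ α : ℕ, (fun n : ℕ => (T ^ n) w) =Θ[atTop] fun n : ℕ => (n : ℝ) ^ α * ‖μ‖ ^ n := by
  classical
  rw [Module.End.mem_maxGenEigenspace] at hw
  set N : Module.End ℂ V := T - μ • 1 with hN
  obtain ⟨α, hα, hα0⟩ : ∃ α, (N ^ (α + 1)) w = 0 ∧ (N ^ α) w ≠ 0 := by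
    have h0 : Nat.find hw ≠ 0 := by
      intro h
      have := Nat.find_spec hw
      rw [h] at this
      simp at this
      exact hw0 this
    refine ⟨Nat.find hw - 1, ?_, ?_⟩
    · rw [Nat.sub_add_cancel (by omega)]
      exact Nat.find_spec hw
    · exact Nat.find_min hw (by omega)
  have hz : ∀ j, α < j → (N ^ j) w = 0 := by
    intro j hj
    obtain ⟨i, rfl⟩ := Nat.exists_eq_add_of_lt hj
    rw [show α + i + 1 = i + (α + 1) by ring, pow_add, Module.End.mul_apply, hα, map_zero]
  have hT : T = N + μ • 1 := by simp [hN]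
  have hform : ∀ n, α ≤ n → (T ^ n) w = ∑ j ∈ Finset.range (α + 1),
      ((n.choose j : ℂ) * μ ^ n) • ((μ⁻¹) ^ j • (N ^ j) w) := by
    intro n hn
    have hc : Commute N (μ • (1 : Module.End ℂ V)) := (Commute.one_right N).smul_right μ
    rw [hT, hc.add_pow, LinearMap.sum_apply]
    symm
    apply Finset.sum_subset_zero_on_sdiff
    · intro x; simp; omega
    · intro x hx
      simp at hx
      have h1 : N ^ x * (μ • (1 : Module.End ℂ V)) ^ (n - x) * (n.choose x : Module.End ℂ V)
         = (μ • (1 : Module.End ℂ V)) ^ (n - x) * (n.choose x : Module.End ℂ V) * N ^ x := by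
        rw [mul_assoc]
        exact (((hc.pow_pow x (n-x)).mul_right ((Nat.cast_commute _ _).symm)).eq)
      rw [h1, Module.End.mul_apply, hz x (by omega), map_zero]
    · intro x hx
      simp at hx
      have h2 : (n.choose x : Module.End ℂ V) = (n.choose x : ℂ) • 1 := by
        ext v; simp [Module.End.natCast_apply, Nat.cast_smul_eq_nsmul]
      rw [h2, smul_pow, one_pow]
      simp only [Module.End.mul_apply, LinearMap.smul_apply, map_smul, Module.End.one_apply, smul_smul]
      congr 1
      rw [pow_sub₀ _ hμ (by omega), inv_pow]; ring
  have hsc : ∀ j : ℕ, (fun n : ℕ => (n.choose j : ℂ) * μ ^ n) =Θ[atTop] fun n : ℕ => (n : ℝ) ^ j * ‖μ‖ ^ n := by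
    intro j
    have h1 := (isTheta_choose j).mul (isTheta_refl (fun n : ℕ => ‖μ‖ ^ n) atTop)
    refine IsTheta.trans ?_ h1
    rw [← isTheta_norm_left, ← isTheta_norm_right]
    simp only [norm_mul, norm_pow, norm_norm, RCLike.norm_natCast]
    exact isTheta_refl _ _
  refine ⟨α, ?_⟩
  have hev : (fun n : ℕ => (T ^ n) w) =ᶠ[atTop] fun n => ∑ j ∈ Finset.range (α + 1),
      ((n.choose j : ℂ) * μ ^ n) • ((μ⁻¹) ^ j • (N ^ j) w) := by
    filter_upwards [eventually_ge_atTop α] with n hn using hform n hn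
  refine hev.trans_isTheta ?_
  simp only [Finset.sum_range_succ]
  have hlast : (fun n : ℕ => ((n.choose α : ℂ) * μ ^ n) • ((μ⁻¹) ^ α • (N ^ α) w)) =Θ[atTop]
      fun n : ℕ => (n : ℝ) ^ α * ‖μ‖ ^ n := by
    have hne : (μ⁻¹) ^ α • (N ^ α) w ≠ 0 := smul_ne_zero (pow_ne_zero _ (inv_ne_zero hμ)) hα0
    have := (hsc α).smul (isTheta_const_const (l := atTop (α := ℕ)) hne (one_ne_zero (α := ℝ)))
    simpa using this
  have hfirst : (fun n : ℕ => ∑ j ∈ Finset.range α, ((n.choose j : ℂ) * μ ^ n) • ((μ⁻¹) ^ j • (N ^ j) w))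
      =o[atTop] fun n : ℕ => (n : ℝ) ^ α * ‖μ‖ ^ n := by
    apply IsLittleO.fun_sum
    intro j hj
    have h1 := (hsc j).1.smul (isBigO_const_const ((μ⁻¹) ^ j • (N ^ j) w) (one_ne_zero (α := ℝ)) (atTop (α := ℕ)))
    simp only [smul_eq_mul, mul_one] at h1
    refine h1.trans_isLittleO ?_
    refine IsLittleO.mul_isBigO ?_ (isBigO_refl _ _)
    exact (isLittleO_pow_pow_atTop_of_lt (Finset.mem_range.1 hj)).comp_tendsto tendsto_natCast_atTop_atTop
  exact hfirst.add_isTheta hlast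

lemma dom {r R : ℝ} (hr : 0 < r) (hR : 0 < R) {j k : ℕ} (h : toLex (r, j) ≤ toLex (R, k)) :
    (fun n : ℕ => (n : ℝ) ^ j * r ^ n) =O[atTop] fun n : ℕ => (n : ℝ) ^ k * R ^ n := by
  rw [Prod.Lex.toLex_le_toLex] at h
  have key : ∀ᶠ n : ℕ in atTop, 1 ≤ n := eventually_ge_atTop 1
  rcases h with h | ⟨h, h'⟩
  · refine (isLittleO_pow_const_mul_const_pow_const_pow_of_norm_lt j (by rwa [Real.norm_of_nonneg hr.le])).isBigO.trans ?_
    apply IsBigO.of_bound 1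
    filter_upwards [key] with n hn
    have : (1:ℝ) ≤ (n:ℝ)^k := one_le_pow₀ (by exact_mod_cast hn)
    rw [norm_mul, one_mul]
    apply le_mul_of_one_le_left (norm_nonneg _)
    rwa [Real.norm_of_nonneg (by positivity)]
  · dsimp at h h'
    subst h
    apply IsBigO.mul _ (isBigO_refl _ _)
    apply IsBigO.of_bound 1
    filter_upwards [key] with n hn
    rw [Real.norm_of_nonneg (by positivity), Real.norm_of_nonneg (by positivity), one_mul]
    exact pow_le_pow_right₀ (by exact_mod_cast hn) h'

lemma main1 {V : Type*} [NormedAddCommGroup V] [NormedSpace ℂ V] [FiniteDimensional ℂ V]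
    (T : Module.End ℂ V) (v : V) :
    (∀ᶠ n : ℕ in atTop, (T ^ n) v = 0) ∨ ∃ (α : ℕ) (r : ℝ), 0 < r ∧ 
     (fun n : ℕ => (T ^ n) v) =Θ[atTop] fun n : ℕ => (n : ℝ) ^ α * r ^ n := by
  classical
  have hv : v ∈ ⨆ μ, T.maxGenEigenspace μ := by
    rw [Module.End.iSup_maxGenEigenspace_eq_top]; trivial
  obtain ⟨f, hf, hsum⟩ := (Submodule.mem_iSup_iff_exists_finsupp _ _).1 hv
  have hTf : ∀ n μ, (T ^ n) (f μ) ∈ T.maxGenEigenspace μ := fun n μ =>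
    Module.End.mapsTo_maxGenEigenspace_of_comm ((Commute.refl T).pow_right n) μ (hf μ)
  have hTv : ∀ n, (T ^ n) v = ∑ μ ∈ f.support, (T ^ n) (f μ) := by
    intro n; rw [← hsum, Finsupp.sum, map_sum]
  have hzero : ∀ᶠ n : ℕ in atTop, (T ^ n) (f 0) = 0 := by
    have := hf 0
    rw [Module.End.mem_maxGenEigenspace] at this
    obtain ⟨k, hk⟩ := this
    simp only [zero_smul, sub_zero] at hk
    filter_upwards [eventually_ge_atTop k] with n hn
    obtain ⟨i, rfl⟩ := Nat.exists_eq_add_of_le hn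
    rw [add_comm, pow_add, Module.End.mul_apply, hk, map_zero]
  set s := f.support.erase 0 with hs
  have hTv' : ∀ᶠ n : ℕ in atTop, (T ^ n) v = ∑ μ ∈ s, (T ^ n) (f μ) := by
    filter_upwards [hzero] with n hn
    rw [hTv n, hs]
    symm
    exact Finset.sum_erase (f := fun μ => (T ^ n) (f μ)) _ hn
  rcases s.eq_empty_or_nonempty with he | hne
  · left
    filter_upwards [hTv'] with n hn
    simp [hn, he]
  right
  have hc : ∀ μ, ∃ α : ℕ, μ ∈ s → (fun n : ℕ => (T ^ n) (f μ)) =Θ[atTop] fun n : ℕ => (n : ℝ) ^ α * ‖μ‖ ^ n := by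
    intro μ
    by_cases h : μ ∈ s
    · have h' := Finset.mem_erase.1 h
      obtain ⟨α, hα⟩ := comp1 T μ h'.1 (f μ) (Finsupp.mem_support_iff.1 h'.2) (hf μ)
      exact ⟨α, fun _ => hα⟩
    · exact ⟨0, fun h2 => absurd h2 h⟩
  choose A hA using hc
  obtain ⟨m, hm, hmax⟩ := s.exists_max_image (fun μ => toLex (‖μ‖, A μ)) hne
  have hpos : ∀ μ ∈ s, 0 < ‖μ‖ := fun μ h => norm_pos_iff.2 (Finset.mem_erase.1 h).1
  refine ⟨A m, ‖m‖, hpos m hm, ?_, ?_⟩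
  · refine EventuallyEq.trans_isBigO hTv' ?_
    apply IsBigO.fun_sum
    intro μ hμ
    exact (hA μ hμ).1.trans (dom (hpos μ hμ) (hpos m hm) (hmax μ hμ))
  · refine (hA m hm).2.trans ?_
    have hcompl : IsCompl (T.maxGenEigenspace m) (⨆ μ, ⨆ (_ : μ ≠ m), T.maxGenEigenspace μ) := by
      refine ⟨T.independent_maxGenEigenspace m, ?_⟩
      rw [codisjoint_iff, eq_top_iff, ← Module.End.iSup_maxGenEigenspace_eq_top T]
      apply iSup_le
      intro μ
      by_cases h : μ = m
      · subst h; exact le_sup_left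
      · exact le_sup_of_le_right (le_iSup₂_of_le μ h le_rfl)
    let P : V →L[ℂ] V := LinearMap.toContinuousLinearMap (Submodule.projection _ _ hcompl)
    have hP : ∀ᶠ n : ℕ in atTop, (T ^ n) (f m) = P ((T ^ n) v) := by
      filter_upwards [hTv'] with n hn
      rw [hn, map_sum, Finset.sum_eq_single_of_mem m hm]
      · exact (Submodule.projection_apply_of_mem_left hcompl (hTf n m)).symm
      · intro μ hμ hne
        refine (Submodule.projection_apply_eq_zero_iff hcompl).2 ?_
        exact (le_iSup₂_of_le (f := fun μ (_ : μ ≠ m) => T.maxGenEigenspace μ) μ hne le_rfl) (hTf n μ)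
    exact EventuallyEq.trans_isBigO hP (P.isBigO_comp _ _)

lemma recur (a : ℕ → ℝ) (p q : Polynomial ℝ) (hq : q ≠ 0)
    (h : (q : PowerSeries ℝ) * PowerSeries.mk a = (p : PowerSeries ℝ)) :
    ∃ (k : ℕ) (c : ℕ → ℝ), 0 < k ∧ ∀ n, p.natDegree ≤ n →
      a (n + k) = ∑ i ∈ Finset.range k, c i * a (n + i) := by
  set r := q.natTrailingDegree with hr
  set k := q.natDegree + 1 with hk
  have hr0 : q.coeff r ≠ 0 := by
    simpa [hr] using Polynomial.trailingCoeff_nonzero_iff_nonzero.2 hq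
  refine ⟨k, fun i => -(q.coeff (r + k - i) / q.coeff r), by omega, ?_⟩
  intro n hn
  have h1 := congrArg (PowerSeries.coeff (n + k + r)) h
  rw [PowerSeries.coeff_mul, Polynomial.coeff_coe,
    Polynomial.coeff_eq_zero_of_natDegree_lt (by omega : p.natDegree < n + k + r),
    Finset.Nat.sum_antidiagonal_eq_sum_range_succ_mk] at h1
  simp only [Polynomial.coeff_coe, PowerSeries.coeff_mk] at h1
  rw [show (n + k + r).succ = r + ((k + 1) + n) by omega, Finset.sum_range_add,
    Finset.sum_range_add _ (k+1) n, Finset.sum_range_succ'] at h1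
  rw [Finset.sum_eq_zero (s := Finset.range r), Finset.sum_eq_zero (s := Finset.range n)] at h1
  · have h2 : ∀ j ∈ Finset.range k, q.coeff (r + (k - 1 - j + 1)) * a (n + k + r - (r + (k - 1 - j + 1)))
       = q.coeff (r + k - j) * a (n + j) := by
      intro j hj
      have := Finset.mem_range.1 hj
      congr 2 <;> omega
    rw [← Finset.sum_range_reflect _ k, zero_add, add_zero, Finset.sum_congr rfl h2] at h1
    simp only [add_zero] at h1
    rw [show n + k + r - r = n + k by omega] at h1
    have h3 : ∑ i ∈ Finset.range k, -(q.coeff (r + k - i) / q.coeff r) * a (n + i)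
      = -(∑ i ∈ Finset.range k, q.coeff (r + k - i) * a (n + i)) / q.coeff r := by
      rw [← Finset.sum_neg_distrib, Finset.sum_div]
      refine Finset.sum_congr rfl fun i _ => by ring
    rw [h3]
    field_simp
    linarith
  · intro x _
    rw [Polynomial.coeff_eq_zero_of_natDegree_lt (by omega), zero_mul]
  · intro x hx
    rw [Polynomial.coeff_eq_zero_of_lt_natTrailingDegree (Finset.mem_range.1 hx), zero_mul]

lemma window (E : LinearRecurrence ℂ) (u : ℕ → ℂ) (hu : E.IsSolution u) (n : ℕ) :
    (E.tupleSucc ^ n) (fun i => u i) = fun i : Fin E.order => u (n + i) := by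
  induction n with
  | zero => simp
  | succ n ih =>
    rw [pow_succ', Module.End.mul_apply, ih]
    ext i
    simp only [LinearRecurrence.tupleSucc, LinearMap.coe_mk, AddHom.coe_mk]
    split_ifs with h
    · congr 1; omega
    · rw [← hu n]; congr 1; omega

theorem statement1 (a : ℕ → ℕ) (hpos : ∀ n, 0 < a n)
    (hsub : ∀ m n : ℕ, a (m + n) ≤ a m * a n)
    (hrat : ∃ p q : Polynomial ℝ, q ≠ 0 ∧
      (q : PowerSeries ℝ) * PowerSeries.mk (fun n => (a n : ℝ)) = (p : PowerSeries ℝ)) :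
    ∃ (α : ℕ) (lam C D : ℝ), 1 ≤ lam ∧ 0 < C ∧ C < D ∧
      ∀ n : ℕ, 1 ≤ n →
        C * (n : ℝ) ^ α * lam ^ n ≤ (a n : ℝ) ∧ (a n : ℝ) ≤ D * (n : ℝ) ^ α * lam ^ n := by
  obtain ⟨p, q, hq, h⟩ := hrat
  obtain ⟨k, c, hk, hrec⟩ := recur _ p q hq h
  set N := p.natDegree with hN
  let E : LinearRecurrence ℂ := ⟨k, fun i => (c i : ℂ)⟩
  let u : ℕ → ℂ := fun n => (a (n + N) : ℂ)
  have hu : E.IsSolution u := by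
    intro n
    have h1 := hrec (n + N) (by omega)
    rw [← Fin.sum_univ_eq_sum_range (fun i => c i * (a (n + N + i) : ℝ))] at h1
    have h2 := congrArg (fun x : ℝ => (x : ℂ)) h1
    push_cast at h2
    simp only [u, E]
    rw [show n + k + N = n + N + k by ring, h2]
    refine Finset.sum_congr rfl fun i _ => ?_
    rw [show n + N + (i : ℕ) = n + i + N by ring]
  have hw := window E u hu
  -- the windows
  let W : ℕ → Fin E.order → ℂ := fun n i => u (n + i)
  have hW1 : ∀ n, (a (n + N) : ℝ) ≤ ‖W n‖ := by
    intro n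
    have := norm_le_pi_norm (W n) ⟨0, hk⟩
    simpa [W, u] using this
  have hW2 : ∀ n, ‖W n‖ ≤ (∑ i ∈ Finset.range k, (a i : ℝ)) * (a (n + N) : ℝ) := by
    intro n
    rw [pi_norm_le_iff_of_nonneg (by positivity)]
    intro i
    have h1 : ‖W n i‖ = (a (n + i + N) : ℝ) := by simp [W, u]
    have h2 : (a (n + i + N) : ℝ) ≤ a i * a (n + N) := by
      rw [show n + (i : ℕ) + N = i + (n + N) by ring]
      exact_mod_cast hsub i (n + N)
    rw [h1]
    refine h2.trans ?_
    gcongr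
    exact Finset.single_le_sum (f := fun i => (a i : ℝ)) (fun _ _ => by positivity)
      (Finset.mem_range.2 i.2)
  rcases main1 E.tupleSucc (fun i => u i) with h0 | ⟨α, r, hr, hΘ⟩
  · exfalso
    obtain ⟨n, hn⟩ := h0.exists
    rw [hw n] at hn
    have h1 := hW1 n
    have h2 : W n = 0 := hn
    rw [h2, norm_zero] at h1
    have := hpos (n + N)
    have h3 : (0 : ℝ) < a (n + N) := by exact_mod_cast this
    linarith
  have hΘ' : W =Θ[atTop] fun n : ℕ => (n : ℝ) ^ α * r ^ n := by
    refine IsTheta.trans ?_ hΘ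
    simp only [hw]
    exact isTheta_refl _ _
  have hA : (fun n => (a (n + N) : ℝ)) =Θ[atTop] W := by
    constructor
    · apply IsBigO.of_bound 1
      refine Eventually.of_forall fun n => ?_
      simpa using hW1 n
    · apply IsBigO.of_bound (∑ i ∈ Finset.range k, (a i : ℝ))
      refine Eventually.of_forall fun n => ?_
      simpa using hW2 n
  have hg : (fun n : ℕ => (n : ℝ) ^ α * r ^ n) =Θ[atTop]
      fun n : ℕ => ((n + N : ℕ) : ℝ) ^ α * r ^ (n + N) := by
    apply IsTheta.mul
    · apply IsTheta.pow
      constructor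
      · apply IsBigO.of_bound 1
        refine Eventually.of_forall fun n => ?_
        simp only [RCLike.norm_natCast, one_mul]
        exact_mod_cast Nat.le_add_right n N
      · apply IsBigO.of_bound (1 + N)
        filter_upwards [eventually_ge_atTop 1] with n hn
        simp only [RCLike.norm_natCast]
        norm_cast
        nlinarith
    · simp only [pow_add]
      have := (isTheta_refl (fun n : ℕ => r ^ n) atTop).mul
        (isTheta_const_const (l := atTop (α := ℕ)) (one_ne_zero (α := ℝ)) (pow_pos hr N).ne')
      simpa using this
  have hAg := (hA.trans hΘ').trans hg
  have hfin : (fun n => (a n : ℝ)) =Θ[atTop] fun n : ℕ => (n : ℝ) ^ α * r ^ n := by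
    have hev : ∀ F : ℕ → ℝ, (fun n => F (n + N)) ∘ (fun n => n - N) =ᶠ[atTop] F := by
      intro F
      filter_upwards [eventually_ge_atTop N] with n hn
      simp [Nat.sub_add_cancel hn]
    constructor
    · exact (hAg.1.comp_tendsto (tendsto_sub_atTop_nat N)).congr' (hev (fun n => (a n : ℝ)))
        (hev (fun n => (n : ℝ) ^ α * r ^ n))
    · exact (hAg.2.comp_tendsto (tendsto_sub_atTop_nat N)).congr'
        (hev (fun n => (n : ℝ) ^ α * r ^ n)) (hev (fun n => (a n : ℝ)))
  have hr1 : 1 ≤ r := by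
    by_contra hlt
    push Not at hlt
    have ht := tendsto_pow_const_mul_const_pow_of_abs_lt_one α
      (by rwa [abs_of_pos hr] : |r| < 1)
    have ht2 := hfin.1.trans_tendsto ht
    have h3 := ht2.eventually (gt_mem_nhds (zero_lt_one (α := ℝ)))
    obtain ⟨n, hn⟩ := h3.exists
    have h4 : (1 : ℝ) ≤ a n := by exact_mod_cast hpos n
    linarith
  have hapos : ∀ n, (0 : ℝ) < a n := fun n => by exact_mod_cast hpos n
  obtain ⟨C2, hC2, h2⟩ := bound_of_isBigO_nat_atTop (hfin.1.comp_tendsto (tendsto_add_atTop_nat 1))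
  obtain ⟨C1, hC1, h1⟩ := bound_of_isBigO_nat_atTop (hfin.2.comp_tendsto (tendsto_add_atTop_nat 1))
  refine ⟨α, r, C1⁻¹, C1⁻¹ + C2, hr1, by positivity, by linarith, ?_⟩
  intro n hn
  obtain ⟨m, rfl⟩ := Nat.exists_eq_add_of_le' hn
  have hgp : 0 < ((m + 1 : ℕ) : ℝ) ^ α * r ^ (m + 1) := by positivity
  have e1 := @h1 m (hapos (m + 1)).ne'
  have e2 := @h2 m hgp.ne'
  simp only [Function.comp] at e1 e2
  rw [Real.norm_of_nonneg hgp.le, Real.norm_of_nonneg (hapos (m + 1)).le] at e1 e2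
  constructor
  · rw [mul_assoc, inv_mul_le_iff₀ hC1]
    exact e1
  · rw [mul_assoc, add_mul]
    have : 0 < C1⁻¹ * (((m + 1 : ℕ) : ℝ) ^ α * r ^ (m + 1)) := by positivity
    linarith
end
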